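/- If n is an odd squarefree positive integer and k is any integer, then G_k(n) = (k/n) · √n, where (k/n) is the Jacobi symbol. -/

import Mathlib

open scoped Real

/-- `e(x) = e^{2πix}`. -/
noncomputable def eC (x : ℝ) : ℂ := Complex.exp (2 * Real.pi * Complex.I * x)

/-- `τ_k(n) = Σ_{b mod n} (b/n) e(bk/n)`, where `(·/n)` is the Jacobi symbol. -/
noncomputable def tauG (k : ℤ) (n : ℕ) : ℂ :=
  ∑ b ∈ Finset.range n, (jacobiSym b n : ℂ) * eC (b * k / n)

/-- `G_k(n) = ((1−i)/2 + (−1/n)·(1+i)/2)·τ_k(n)`. -/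
noncomputable def GaussG (k : ℤ) (n : ℕ) : ℂ :=
  ((1 - Complex.I) / 2 + (jacobiSym (-1) n : ℂ) * (1 + Complex.I) / 2) * tauG k n

open Polynomial
open scoped NumberTheorySymbols

/-- The Euler operator `f ↦ X * derivative f` on polynomials. -/
noncomputable def eulerOp (R : Type*) [CommRing R] : R[X] →ₗ[R] R[X] :=
  LinearMap.mulLeft R X ∘ₗ derivative

lemma eulerOp_pow_C_mul_X_pow {R : Type*} [CommRing R] (n : ℕ) (c : R) (j : ℕ) :
    (eulerOp R ^ n) (C c * X ^ j) = C (c * (j : R) ^ n) * X ^ j := by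
  induction n with
  | zero => simp
  | succ n ih =>
    rw [pow_succ', Module.End.mul_apply, ih]
    simp only [eulerOp, LinearMap.comp_apply, LinearMap.mulLeft_apply, derivative_C_mul,
      derivative_X_pow]
    rcases j with _ | j
    · simp
    · simp only [Nat.add_sub_cancel, map_mul, map_pow]
      ring

lemma eval_one_eulerOp_pow {R : Type*} [CommRing R] (n : ℕ) (h : R[X]) :
    ((eulerOp R ^ n) ((X - 1) ^ n * h)).eval 1 = n.factorial * h.eval 1 := by
  induction n generalizing h with
  | zero => simp
  | succ n ih =>
    have key : eulerOp R ((X - 1) ^ (n + 1) * h) =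
        (X - 1) ^ n * (X * (((n : R[X]) + 1) * h + (X - 1) * derivative h)) := by
      simp [eulerOp, derivative_mul, derivative_pow]
      ring
    rw [pow_succ, Module.End.mul_apply, key, ih]
    simp [Nat.factorial_succ]
    ring

lemma factorial_mul_prod_two_mul_odd (m : ℕ) :
    m.factorial * ∏ k ∈ Finset.range m, (2 * (2 * k + 1)) = (2 * m).factorial := by
  induction m with
  | zero => simp
  | succ m ih =>
    rw [Finset.prod_range_succ, Nat.factorial_succ, show 2 * (m + 1) = 2 * m + 1 + 1 by ring,
      Nat.factorial_succ, Nat.factorial_succ, ← ih]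
    ring

/-- The only candidate for the sign relating the quadratic Gauss sum to the product
`∏ (ζ ^ j - ζ ^ (-j))` over odd `j < p` is congruent to `1` modulo `p`. -/
lemma intCast_eq_one_of_gaussSum_eq_mul_prod {m : ℕ} [hp : Fact (2 * m + 1).Prime] {ζ : ℂ}
    (hζ : IsPrimitiveRoot ζ (2 * m + 1)) (ε : ℤ)
    (h : ∑ j ∈ Finset.range (2 * m + 1), (J((j : ℤ) | 2 * m + 1) : ℂ) * ζ ^ j =
      ε * ∏ k ∈ Finset.range m, (ζ ^ (2 * k + 1) - ζ ^ (2 * m - 2 * k))) :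
    (ε : ZMod (2 * m + 1)) = 1 := by
  set p := 2 * m + 1 with hpdef
  have hm : 0 < m := by
    have := hp.out.two_le
    omega
  set f : ℤ[X] := ∑ j ∈ Finset.range p, C (J((j : ℤ) | p)) * X ^ j -
    C ε * ∏ k ∈ Finset.range m, (X ^ (2 * k + 1) - X ^ (2 * m - 2 * k)) with hf
  have hroot : aeval ζ f = 0 := by
    simp only [hf, map_sub, map_sum, map_mul, map_prod, map_pow, aeval_X, aeval_C]
    rw [sub_eq_zero]
    simpa using h
  have hdvd : cyclotomic p ℤ ∣ f := by
    rw [cyclotomic_eq_minpoly hζ hp.out.pos]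
    exact minpoly.isIntegrallyClosed_dvd (hζ.isIntegral hp.out.pos) hroot
  obtain ⟨g, hg⟩ := map_dvd (mapRingHom (Int.castRingHom (ZMod p))) hdvd
  have hcyc : cyclotomic p (ZMod p) = (X - 1) ^ (2 * m) := by
    have := cyclotomic_mul_prime_eq_pow_of_not_dvd (ZMod p) (p := p) (n := 1)
      (by simpa using hp.out.one_lt.ne')
    simpa [hpdef] using this
  simp only [coe_mapRingHom, map_cyclotomic, hcyc] at hg
  have hzero : ((eulerOp (ZMod p) ^ m) (f.map (Int.castRingHom (ZMod p)))).eval 1 = 0 := by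
    rw [hg, two_mul, pow_add, mul_assoc, eval_one_eulerOp_pow]
    simp [hm.ne']
  have hleft : ((eulerOp (ZMod p) ^ m) (∑ j ∈ Finset.range p,
      C ((J((j : ℤ) | p) : ℤ) : ZMod p) * X ^ j)).eval 1 = -1 := by
    have hterm (j : ℕ) : ((J((j : ℤ) | p) : ℤ) : ZMod p) = (j : ZMod p) ^ m := by
      rw [← jacobiSym.legendreSym.to_jacobiSym, legendreSym.eq_pow]
      simp [hpdef, show (2 * m + 1) / 2 = m by omega]
    simp only [map_sum, eulerOp_pow_C_mul_X_pow, hterm, eval_finsetSum, eval_mul, eval_C,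
      eval_pow, eval_X, one_pow, mul_one, ← pow_add, ← two_mul]
    rw [Finset.sum_range_succ']
    have : ∀ j ∈ Finset.range (2 * m), ((j + 1 : ℕ) : ZMod p) ^ (2 * m) = 1 := by
      intro j hj
      have hne : ((j + 1 : ℕ) : ZMod p) ≠ 0 := by
        rw [Ne, ZMod.natCast_eq_zero_iff]
        intro hd
        have := Nat.le_of_dvd (by omega) hd
        simp at hj
        omega
      simpa [hpdef] using ZMod.pow_card_sub_one_eq_one hne
    rw [Finset.sum_congr rfl this]
    have h0 : ((2 * m + 1 : ℕ) : ZMod p) = 0 := ZMod.natCast_self p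
    push_cast at h0
    simp [hm.ne']
    linear_combination h0
  have hright : ((eulerOp (ZMod p) ^ m) (∏ k ∈ Finset.range m,
      (X ^ (2 * k + 1) - X ^ (2 * m - 2 * k)))).eval 1 = -1 := by
    have hfac : ∀ k ∈ Finset.range m, (X ^ (2 * k + 1) - X ^ (2 * m - 2 * k) : (ZMod p)[X]) =
        (X - 1) * (∑ i ∈ Finset.range (2 * k + 1), X ^ i -
          ∑ i ∈ Finset.range (2 * m - 2 * k), X ^ i) := by
      intro k _
      rw [mul_sub, mul_geom_sum, mul_geom_sum]
      ring
    rw [Finset.prod_congr rfl hfac, Finset.prod_mul_distrib, Finset.prod_const, Finset.card_range,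
      eval_one_eulerOp_pow, eval_prod]
    have heval : ∀ k ∈ Finset.range m, (∑ i ∈ Finset.range (2 * k + 1), X ^ i -
          ∑ i ∈ Finset.range (2 * m - 2 * k), X ^ i : (ZMod p)[X]).eval 1 =
        ((2 * (2 * k + 1) : ℕ) : ZMod p) := by
      intro k hk
      have h0 : ((2 * m + 1 : ℕ) : ZMod p) = 0 := ZMod.natCast_self p
      have hk' : 2 * k ≤ 2 * m := by
        have := Finset.mem_range.1 hk
        omega
      simp only [eval_sub, eval_finsetSum, eval_pow, eval_X, one_pow, Finset.sum_const,
        Finset.card_range, nsmul_eq_mul, mul_one, Nat.cast_sub hk']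
      push_cast at h0 ⊢
      linear_combination -h0
    rw [Finset.prod_congr rfl heval, ← Nat.cast_prod, ← Nat.cast_mul,
      factorial_mul_prod_two_mul_odd]
    simpa [hpdef] using ZMod.wilsons_lemma p
  have hmap : f.map (Int.castRingHom (ZMod p)) =
      ∑ j ∈ Finset.range p, C ((J((j : ℤ) | p) : ℤ) : ZMod p) * X ^ j -
      C (ε : ZMod p) * ∏ k ∈ Finset.range m, (X ^ (2 * k + 1) - X ^ (2 * m - 2 * k)) := by
    simp [hf, Polynomial.map_sum, Polynomial.map_prod]
  rw [hmap, map_sub, eval_sub, hleft, ← smul_eq_C_mul, map_smul, eval_smul, hright] at hzero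
  simp at hzero
  linear_combination hzero

lemma prod_range_two_mul {M : Type*} [CommMonoid M] (f : ℕ → M) (m : ℕ) :
    ∏ i ∈ Finset.range (2 * m), f i =
      (∏ k ∈ Finset.range m, f (2 * k)) * ∏ k ∈ Finset.range m, f (2 * k + 1) := by
  induction m with
  | zero => simp
  | succ m ih =>
    rw [show 2 * (m + 1) = 2 * m + 1 + 1 by ring, Finset.prod_range_succ, Finset.prod_range_succ,
      ih, Finset.prod_range_succ, Finset.prod_range_succ]
    simp only [mul_assoc, mul_comm, mul_left_comm]

lemma sq_prod_pow_sub_pow {m : ℕ} {ζ : ℂ} (hζ : IsPrimitiveRoot ζ (2 * m + 1)) :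
    (∏ k ∈ Finset.range m, (ζ ^ (2 * k + 1) - ζ ^ (2 * m - 2 * k))) ^ 2 =
      (-1) ^ m * (2 * m + 1 : ℕ) := by
  have hsq : IsPrimitiveRoot (ζ ^ 2) (2 * m + 1) :=
    hζ.pow_of_coprime 2 (by simp)
  have hprod := hsq.prod_one_sub_pow_eq_order
  rw [prod_range_two_mul, ← Finset.prod_range_reflect (fun k ↦ 1 - (ζ ^ 2) ^ (2 * k + 1 + 1)),
    ← Finset.prod_mul_distrib] at hprod
  have hterm : ∀ k ∈ Finset.range m,
      (1 - (ζ ^ 2) ^ (2 * k + 1)) * (1 - (ζ ^ 2) ^ (2 * (m - 1 - k) + 1 + 1)) =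
        (-1) * (ζ ^ (2 * k + 1) - ζ ^ (2 * m - 2 * k)) ^ 2 := by
    intro k hk
    have hk' := Finset.mem_range.1 hk
    rw [show 2 * (m - 1 - k) + 1 + 1 = 2 * m - 2 * k by omega, ← pow_mul, ← pow_mul,
      mul_comm 2, mul_comm 2 (2 * m - 2 * k), pow_mul, pow_mul]
    have hone : ζ ^ (2 * k + 1) * ζ ^ (2 * m - 2 * k) = 1 := by
      rw [← pow_add, show 2 * k + 1 + (2 * m - 2 * k) = 2 * m + 1 by omega, hζ.pow_eq_one]
    linear_combination (ζ ^ (2 * k + 1) * ζ ^ (2 * m - 2 * k) - 1) * hone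
  rw [Finset.prod_congr rfl hterm, Finset.prod_mul_distrib, Finset.prod_const, Finset.card_range,
    Finset.prod_pow] at hprod
  push_cast at hprod ⊢
  rw [← hprod, ← mul_assoc, ← mul_pow]
  simp

lemma eC_add (x y : ℝ) : eC (x + y) = eC x * eC y := by
  simp only [eC, ← Complex.exp_add]
  push_cast
  ring_nf

lemma eC_natCast_mul (j : ℕ) (x : ℝ) : eC (j * x) = eC x ^ j := by
  simp only [eC, ← Complex.exp_nat_mul]
  push_cast
  ring_nf

lemma eC_intCast (z : ℤ) : eC z = 1 := by
  rw [eC, Complex.exp_eq_one_iff]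
  exact ⟨z, by push_cast; ring⟩

/-- The complex-valued quadratic character modulo a prime. -/
noncomputable def complexQuadraticChar (p : ℕ) [Fact p.Prime] : MulChar (ZMod p) ℂ :=
  (quadraticChar (ZMod p)).ringHomComp (Int.castRingHom ℂ)

lemma complexQuadraticChar_intCast (p : ℕ) [Fact p.Prime] (a : ℤ) :
    complexQuadraticChar p (a : ZMod p) = (J(a | p) : ℂ) := by
  rw [← jacobiSym.legendreSym.to_jacobiSym]
  rfl

lemma complexQuadraticChar_isQuadratic (p : ℕ) [Fact p.Prime] :
    (complexQuadraticChar p).IsQuadratic :=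
  (quadraticChar_isQuadratic (ZMod p)).comp _

lemma complexQuadraticChar_ne_one (p : ℕ) [Fact p.Prime] (hp : p ≠ 2) :
    complexQuadraticChar p ≠ 1 :=
  (MulChar.ringHomComp_ne_one_iff (RingHom.injective_int _)).mpr
    (quadraticChar_ne_one (by rwa [ZMod.ringChar_zmod_n]))

lemma tauG_eq_gaussSum (p : ℕ) [Fact p.Prime] (k : ℤ) :
    tauG k p = gaussSum (complexQuadraticChar p) (ZMod.stdAddChar.mulShift (k : ZMod p)) := by
  rw [tauG, gaussSum]
  refine Finset.sum_nbij' (fun b ↦ (b : ZMod p)) ZMod.val (by simp)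
    (by simpa using fun a ↦ ZMod.val_lt a) ?_ (by simp) ?_
  · intro b hb
    exact ZMod.val_cast_of_lt (Finset.mem_range.1 hb)
  · intro b _
    have hc := complexQuadraticChar_intCast p b
    have hs := ZMod.stdAddChar_coe (N := p) (k * b)
    push_cast at hc hs
    rw [hc, AddChar.mulShift_apply, hs, eC]
    push_cast
    ring_nf

lemma tauG_prime (p : ℕ) [Fact p.Prime] (hp : p ≠ 2) (k : ℤ) :
    tauG k p = J(k | p) * tauG 1 p := by
  rw [tauG_eq_gaussSum, tauG_eq_gaussSum, Int.cast_one, AddChar.mulShift_one,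
    ← complexQuadraticChar_intCast]
  rcases eq_or_ne (k : ZMod p) 0 with hk | hk
  · rw [hk, AddChar.mulShift_zero, gaussSum_one_right (complexQuadraticChar_ne_one p hp),
      MulChar.map_zero, zero_mul]
  · have h := gaussSum_mulShift_eq (complexQuadraticChar p) ZMod.stdAddChar (Units.mk0 _ hk)
    rwa [(complexQuadraticChar_isQuadratic p).inv, Units.val_mk0] at h

lemma tauG_one_sq (p : ℕ) [Fact p.Prime] (hp : p ≠ 2) :
    tauG 1 p ^ 2 = J(-1 | p) * p := by
  rw [tauG_eq_gaussSum, Int.cast_one, AddChar.mulShift_one,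
    gaussSum_sq (complexQuadraticChar_ne_one p hp) (complexQuadraticChar_isQuadratic p)
      (ZMod.isPrimitive_stdAddChar p), ← complexQuadraticChar_intCast, ZMod.card]
  push_cast
  rfl

lemma eC_half_root (m : ℕ) :
    eC ((m + 1) / (2 * m + 1 : ℕ)) = -Complex.exp (π / (2 * m + 1) * Complex.I) := by
  have h : (2 * m + 1 : ℂ) ≠ 0 := by exact_mod_cast Nat.succ_ne_zero (2 * m)
  rw [eC, neg_eq_neg_one_mul, ← Complex.exp_pi_mul_I, ← Complex.exp_add]
  congr 1
  push_cast
  field_simp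
  ring

lemma eC_half_root_pow_sub_pow {m k : ℕ} (hk : k < m) :
    eC ((m + 1) / (2 * m + 1 : ℕ)) ^ (2 * k + 1) -
        eC ((m + 1) / (2 * m + 1 : ℕ)) ^ (2 * m - 2 * k) =
      -Complex.I * (2 * Real.sin (π * (2 * k + 1) / (2 * m + 1)) : ℝ) := by
  have h : (2 * m + 1 : ℂ) ≠ 0 := by exact_mod_cast Nat.succ_ne_zero (2 * m)
  have hsub : ((2 * m - 2 * k : ℕ) : ℂ) = 2 * m - 2 * k := by
    rw [Nat.cast_sub (by omega)]
    push_cast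
    rfl
  have hodd : Odd (2 * k + 1) := by simp
  have heven : Even (2 * m - 2 * k) := ⟨m - k, by omega⟩
  rw [eC_half_root, hodd.neg_pow, heven.neg_pow, ← Complex.exp_nat_mul, ← Complex.exp_nat_mul]
  set θ : ℂ := π * (2 * k + 1) / (2 * m + 1) with hθ
  have h1 : ((2 * k + 1 : ℕ) : ℂ) * (π / (2 * m + 1) * Complex.I) = θ * Complex.I := by
    rw [hθ]
    push_cast
    ring
  have h2 : ((2 * m - 2 * k : ℕ) : ℂ) * (π / (2 * m + 1) * Complex.I) =
      π * Complex.I + -θ * Complex.I := by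
    rw [hθ, hsub]
    field_simp
    ring
  rw [h1, h2, Complex.exp_add, Complex.exp_pi_mul_I]
  push_cast
  rw [← hθ, Complex.sin]
  linear_combination -(Complex.exp (θ * Complex.I) - Complex.exp (-θ * Complex.I)) * Complex.I_sq

lemma tauG_half {m : ℕ} [hp : Fact (2 * m + 1).Prime] :
    tauG (m + 1) (2 * m + 1) = (-Complex.I) ^ m * (Real.sqrt (2 * m + 1 : ℕ) : ℂ) := by
  have hm : 0 < m := by
    have := hp.out.two_le
    omega
  have hp2 : 2 * m + 1 ≠ 2 := by omega
  set ζ := eC ((m + 1) / (2 * m + 1 : ℕ)) with hζdef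
  set P := ∏ k ∈ Finset.range m, (ζ ^ (2 * k + 1) - ζ ^ (2 * m - 2 * k)) with hP
  have hζ : IsPrimitiveRoot ζ (2 * m + 1) := by
    have h := (Complex.isPrimitiveRoot_exp (2 * m + 1) (by omega)).pow_of_coprime (m + 1)
      (by
        rw [show 2 * m + 1 = m + (m + 1) by ring, Nat.coprime_add_self_right]
        simp)
    convert h using 1
    rw [hζdef, eC, ← Complex.exp_nat_mul]
    push_cast
    ring_nf
  have htau : tauG (m + 1) (2 * m + 1) =
      ∑ j ∈ Finset.range (2 * m + 1), (J((j : ℤ) | 2 * m + 1) : ℂ) * ζ ^ j := by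
    refine Finset.sum_congr rfl fun j _ ↦ ?_
    rw [hζdef, ← eC_natCast_mul]
    push_cast
    ring_nf
  have hPsq : P ^ 2 = (-1) ^ m * (2 * m + 1 : ℕ) := sq_prod_pow_sub_pow hζ
  have hJ : J((m + 1 : ℤ) | 2 * m + 1) ^ 2 = 1 := by
    refine jacobiSym.sq_one (?_ : Nat.gcd (m + 1) (2 * m + 1) = 1)
    rw [show 2 * m + 1 = m + (m + 1) by ring, Nat.gcd_add_self_right]
    simp
  have hneg : J(-1 | 2 * m + 1) = (-1) ^ m := by
    rw [jacobiSym.at_neg_one (by simp), ZMod.χ₄_eq_neg_one_pow (by omega)]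
    congr 1
    omega
  have hsq : tauG (m + 1) (2 * m + 1) ^ 2 = P ^ 2 := by
    rw [tauG_prime _ hp2, mul_pow, tauG_one_sq _ hp2, hPsq, hneg, ← Int.cast_pow, hJ]
    push_cast
    ring
  have hPtau : tauG (m + 1) (2 * m + 1) = P := by
    rcases sq_eq_sq_iff_eq_or_eq_neg.1 hsq with h | h
    · exact h
    · have hone := intCast_eq_one_of_gaussSum_eq_mul_prod hζ (-1) (by
        rw [← htau, h]
        push_cast
        ring)
      have : Fact (2 < 2 * m + 1) := ⟨by omega⟩
      exact absurd hone (by simpa using ZMod.neg_one_ne_one)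
  set S : ℝ := ∏ k ∈ Finset.range m, (2 * Real.sin (π * (2 * k + 1) / (2 * m + 1))) with hS
  have hPS : P = (-Complex.I) ^ m * (S : ℂ) := by
    rw [hP, hS, Finset.prod_congr rfl fun k hk ↦ eC_half_root_pow_sub_pow (Finset.mem_range.1 hk),
      Finset.prod_mul_distrib, Finset.prod_const, Finset.card_range, Complex.ofReal_prod]
  have hSpos : 0 < S := by
    refine Finset.prod_pos fun k hk ↦ mul_pos two_pos (Real.sin_pos_of_pos_of_lt_pi ?_ ?_)
    · positivity
    · have hk' : (k : ℝ) < m := by exact_mod_cast Finset.mem_range.1 hk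
      rw [div_lt_iff₀ (by positivity)]
      gcongr
  have hSsq : S ^ 2 = (2 * m + 1 : ℕ) := by
    rw [hPS, mul_pow, ← pow_mul, mul_comm m, pow_mul, neg_sq, Complex.I_sq] at hPsq
    exact_mod_cast mul_left_cancel₀ (pow_ne_zero m (neg_ne_zero.2 one_ne_zero)) hPsq
  rw [hPtau, hPS, ← hSsq, Real.sqrt_sq hSpos.le]

lemma GaussG_prime {p : ℕ} (hp : p.Prime) (hodd : Odd p) (k : ℤ) :
    GaussG k p = J(k | p) * (Real.sqrt p : ℂ) := by
  obtain ⟨m, rfl⟩ := hodd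
  have : Fact (2 * m + 1).Prime := ⟨hp⟩
  have hp2 : 2 * m + 1 ≠ 2 := by omega
  have hJ : J(2 | 2 * m + 1) * J((m + 1 : ℤ) | 2 * m + 1) = 1 := by
    rw [← jacobiSym.mul_left, jacobiSym.mod_left' (a₂ := 1), jacobiSym.one_left]
    push_cast
    rw [show (2 * (m + 1) : ℤ) = 1 + (2 * m + 1) by ring, Int.add_emod_right]
  have hone : tauG 1 (2 * m + 1) =
      J(2 | 2 * m + 1) * ((-Complex.I) ^ m * (Real.sqrt (2 * m + 1 : ℕ) : ℂ)) := by
    rw [← tauG_half, tauG_prime _ hp2 (m + 1), ← mul_assoc, ← Int.cast_mul, hJ]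
    simp
  have hsign : ((1 - Complex.I) / 2 + (J(-1 | 2 * m + 1) : ℂ) * (1 + Complex.I) / 2) *
      (J(2 | 2 * m + 1) * (-Complex.I) ^ m) = 1 := by
    rw [jacobiSym.at_neg_one (by simp), jacobiSym.at_two (by simp),
      ZMod.χ₄_nat_eq_if_mod_four, ZMod.χ₈_nat_eq_if_mod_eight]
    have hI : (-Complex.I) ^ m = (-Complex.I) ^ (m % 4) := by
      conv_lhs => rw [← Nat.div_add_mod m 4, pow_add, pow_mul]
      simp [Even.neg_pow (by decide : Even 4)]
    rw [hI]
    have hI2 := Complex.I_sq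
    have hodd : (2 * m + 1) % 2 = 1 := by omega
    rcases (by omega : m % 4 = 0 ∨ m % 4 = 1 ∨ m % 4 = 2 ∨ m % 4 = 3) with h | h | h | h
    · simp [h, hodd, show (2 * m + 1) % 4 = 1 by omega,
        show (2 * m + 1) % 8 = 1 by omega]
      ring
    · simp [h, hodd, show (2 * m + 1) % 4 = 3 by omega,
        show (2 * m + 1) % 8 = 3 by omega]
      linear_combination -hI2
    · simp [h, hodd, show (2 * m + 1) % 4 = 1 by omega,
        show (2 * m + 1) % 8 = 5 by omega]
      ring
    · simp [h, hodd, show (2 * m + 1) % 4 = 3 by omega,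
        show (2 * m + 1) % 8 = 7 by omega]
      linear_combination (Complex.I ^ 2 - 1) * hI2
  rw [GaussG, tauG_prime _ hp2, hone]
  linear_combination (J(k | 2 * m + 1) : ℂ) * (Real.sqrt (2 * m + 1 : ℕ) : ℂ) * hsign

lemma tauG_mul {p q : ℕ} (hp : 0 < p) (hq : 0 < q) (hpq : p.Coprime q) (k : ℤ) :
    tauG k (p * q) = J(q | p) * J(p | q) * (tauG k p * tauG k q) := by
  have hterm (u v : ℕ) : (J(((u * q + v * p) % (p * q) : ℕ) | p * q) : ℂ) *
      eC (((u * q + v * p) % (p * q) : ℕ) * k / (p * q : ℕ)) =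
      J(q | p) * J(p | q) * ((J(u | p) * eC (u * k / p)) * (J(v | q) * eC (v * k / q))) := by
    have hjac : J(((u * q + v * p) % (p * q) : ℕ) | p * q) =
        J(u | p) * J(q | p) * (J(v | q) * J(p | q)) := by
      push_cast
      rw [← Nat.cast_mul p q, ← jacobiSym.mod_left, jacobiSym.mul_right' _ hp.ne' hq.ne',
        jacobiSym.mod_left' (a₂ := u * q) (b := p) (by simp),
        jacobiSym.mod_left' (a₂ := v * p) (b := q) (by simp), jacobiSym.mul_left,
        jacobiSym.mul_left]
    have hexp : eC (((u * q + v * p) % (p * q) : ℕ) * k / (p * q : ℕ)) =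
        eC (u * k / p) * eC (v * k / q) := by
      have hdiv := Nat.mod_add_div (u * q + v * p) (p * q)
      set r := (u * q + v * p) % (p * q)
      set s := (u * q + v * p) / (p * q)
      have hp' : (p : ℝ) ≠ 0 := by exact_mod_cast hp.ne'
      have hq' : (q : ℝ) ≠ 0 := by exact_mod_cast hq.ne'
      have hdiv' : (r : ℝ) + p * q * s = u * q + v * p := by exact_mod_cast hdiv
      rw [← eC_add, ← mul_one (eC _), ← eC_intCast (s * k), ← eC_add]
      congr 1
      push_cast
      field_simp
      linear_combination (k : ℝ) * hdiv'
    rw [hjac, hexp]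
    push_cast
    ring
  have hmaps : Set.MapsTo (fun x : ℕ × ℕ ↦ (x.1 * q + x.2 * p) % (p * q))
      (Finset.range p ×ˢ Finset.range q : Finset (ℕ × ℕ)) (Finset.range (p * q) : Finset ℕ) := by
    intro x _
    simpa using Nat.mod_lt _ (Nat.mul_pos hp hq)
  have hinj : Set.InjOn (fun x : ℕ × ℕ ↦ (x.1 * q + x.2 * p) % (p * q))
      (Finset.range p ×ˢ Finset.range q : Finset (ℕ × ℕ)) := by
    rintro ⟨u, v⟩ hx ⟨u', v'⟩ hy (h : _ ≡ _ [MOD p * q])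
    simp only [Finset.coe_product, Finset.coe_range, Set.mem_prod, Set.mem_Iio] at hx hy
    have hu : u * q ≡ u' * q [MOD p] := by
      simpa [Nat.ModEq] using h.of_mul_right q
    have hv : v * p ≡ v' * p [MOD q] := by
      simpa [Nat.ModEq] using h.of_mul_left p
    rw [Prod.mk.injEq]
    exact ⟨(Nat.ModEq.cancel_right_of_coprime hpq hu).eq_of_lt_of_lt hx.1 hy.1,
      (Nat.ModEq.cancel_right_of_coprime hpq.symm hv).eq_of_lt_of_lt hx.2 hy.2⟩
  have hsurj := Finset.surjOn_of_injOn_of_card_le _ hmaps hinj (by simp)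
  rw [tauG, tauG, tauG, Finset.sum_mul_sum, ← Finset.sum_product', Finset.mul_sum]
  exact (Finset.sum_nbij _ hmaps hinj hsurj fun x _ ↦ (hterm x.1 x.2).symm).symm

lemma GaussG_mul {p q : ℕ} (hp : Odd p) (hq : Odd q) (hpq : p.Coprime q) (k : ℤ) :
    GaussG k (p * q) = GaussG k p * GaussG k q := by
  have hsq : J((p : ℤ) | q) ^ 2 = 1 := jacobiSym.sq_one (by simpa using hpq)
  have hsq' : (J((p : ℤ) | q) : ℂ) ^ 2 = 1 := by exact_mod_cast hsq
  have hneg : J(-1 | p * q) = J(-1 | p) * J(-1 | q) :=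
    jacobiSym.mul_right' _ hp.pos.ne' hq.pos.ne'
  have hI := Complex.I_sq
  simp only [GaussG]
  rw [tauG_mul hp.pos hq.pos hpq, hneg]
  rcases Nat.odd_mod_four_iff.1 (Nat.odd_iff.1 hp) with h | h <;>
  rcases Nat.odd_mod_four_iff.1 (Nat.odd_iff.1 hq) with h' | h'
  · rw [jacobiSym.quadratic_reciprocity_one_mod_four' hq h]
    simp only [jacobiSym.at_neg_one hp, jacobiSym.at_neg_one hq, ZMod.χ₄_nat_one_mod_four h,
      ZMod.χ₄_nat_one_mod_four h']
    push_cast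
    linear_combination (tauG k p * tauG k q) * hsq'
  · rw [jacobiSym.quadratic_reciprocity_one_mod_four' hq h]
    simp only [jacobiSym.at_neg_one hp, jacobiSym.at_neg_one hq, ZMod.χ₄_nat_one_mod_four h,
      ZMod.χ₄_nat_three_mod_four h']
    push_cast
    linear_combination -Complex.I * (tauG k p * tauG k q) * hsq'
  · rw [jacobiSym.quadratic_reciprocity_one_mod_four h' hp]
    simp only [jacobiSym.at_neg_one hp, jacobiSym.at_neg_one hq, ZMod.χ₄_nat_three_mod_four h,
      ZMod.χ₄_nat_one_mod_four h']
    push_cast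
    linear_combination -Complex.I * (tauG k p * tauG k q) * hsq'
  · rw [jacobiSym.quadratic_reciprocity_three_mod_four h' h]
    simp only [jacobiSym.at_neg_one hp, jacobiSym.at_neg_one hq, ZMod.χ₄_nat_three_mod_four h,
      ZMod.χ₄_nat_three_mod_four h']
    push_cast
    linear_combination -(tauG k p * tauG k q) * hsq' - (tauG k p * tauG k q) * hI

/-- If `n` is an odd squarefree positive integer and `k` is any integer, then
`G_k(n) = (k/n)·√n`, where `(k/n)` is the Jacobi symbol. -/
theorem stmt_8 (n : ℕ) (hn : 0 < n) (hno : Odd n) (hnsf : Squarefree n) (k : ℤ) :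
    GaussG k n = (jacobiSym k n : ℂ) * (Real.sqrt n : ℂ) := by
  induction n using Nat.recOnMul with
  | zero => simp at hn
  | one =>
    simp [GaussG, tauG, eC]
    ring
  | prime p hp => exact GaussG_prime hp hno k
  | mul a b iha ihb =>
    obtain ⟨ha, hb⟩ := Nat.odd_mul.1 hno
    have hab := Nat.coprime_of_squarefree_mul hnsf
    rw [GaussG_mul ha hb hab, iha ha.pos ha (hnsf.of_mul_left), ihb hb.pos hb (hnsf.of_mul_right),
      jacobiSym.mul_right' _ ha.pos.ne' hb.pos.ne', Nat.cast_mul, Real.sqrt_mul (by positivity)]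
    push_cast
    ring
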